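/- Let K be a commutative ring and (c_m)_{m≥1} a sequence of elements of K. For integers 1 ≤ i ≤ j define Q(i,j) ∈ K by Q(i,i) = 0, Q(i,i+1) = 1, and Q(i,j) = the (1,1)-entry of the matrix product η(c_{j−2})·η(c_{j−3})⋯η(c_{i+1})·η(c_i) for j ≥ i+2. Then for all integers 1 ≤ i < j ≤ k: Q(i,j) = Q(i,k)·Q(j,k+1) − Q(j,k)·Q(i,k+1). -/

import Mathlib

/-- The matrix `η(x) = [[x, -1], [1, 0]]`. -/
def eta {K : Type*} [CommRing K] (x : K) : Matrix (Fin 2) (Fin 2) K :=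
  !![x, -1; 1, 0]

/-- `Q(i,j)` for `i ≤ j`: `Q(i,i) = 0`, `Q(i,i+1) = 1` (the empty product), and for
`j ≥ i+2` the `(1,1)`-entry of `η(c_{j-2})·η(c_{j-3})⋯η(c_{i+1})·η(c_i)`. -/
def Qf {K : Type*} [CommRing K] (c : ℕ → K) (i j : ℕ) : K :=
  if i = j then 0
  else ((((List.range (j - 1 - i)).map (fun k => eta (c (i + k)))).reverse).prod) 0 0

section Recurrence

variable {K : Type*} [CommRing K] (c : ℕ → K) (i : ℕ)

theorem Qf_self : Qf c i i = 0 := by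
  simp [Qf]

theorem Qf_succ_self : Qf c i (i + 1) = 1 := by
  simp [Qf]

theorem Qf_add_two {i k : ℕ} (hik : i ≤ k) :
    Qf c i (k + 2) = c k * Qf c i (k + 1) - Qf c i k := by
  obtain ⟨n, rfl⟩ := Nat.exists_eq_add_of_le hik
  cases n with
  | zero => simp [Qf, eta]
  | succ n =>
    have e₁ : i + (n + 1) + 2 - 1 - i = n + 1 + 1 := by omega
    have e₂ : i + (n + 1) + 1 - 1 - i = n + 1 := by omega
    have e₃ : i + (n + 1) - 1 - i = n := by omega
    unfold Qf
    rw [if_neg (by omega), if_neg (by omega), if_neg (by omega), e₁, e₂, e₃]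
    simp [List.range_succ, eta, Matrix.vecMul_eq_sum, Fin.sum_univ_two, add_assoc]
    ring

end Recurrence

/-- For all `1 ≤ i < j ≤ k` : `Q(i,j) = Q(i,k)·Q(j,k+1) − Q(j,k)·Q(i,k+1)`. -/
theorem stmt_13 {K : Type*} [CommRing K] (c : ℕ → K) (i j k : ℕ)
    (h1 : 1 ≤ i) (h2 : i < j) (h3 : j ≤ k) :
    Qf c i j = Qf c i k * Qf c j (k + 1) - Qf c j k * Qf c i (k + 1) := by
  induction k, h3 using Nat.le_induction with
  | base => simp [Qf_self, Qf_succ_self]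
  | succ k hjk ih =>
    rw [Qf_add_two c hjk, Qf_add_two c (h2.le.trans hjk), ih]
    ring
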